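/- For all integers s ≥ 1 and k ≥ 0, the R/I-module Ext_R^k(I^s, R/I) is free. -/

import Mathlib

open CategoryTheory

noncomputable section

/-- The functor `Tor_k^R(R/I, -)` on `R`-modules. -/
def TorF (R : Type) [CommRing R] (I : Ideal R) (k : ℕ) :
    ModuleCat R ⥤ ModuleCat R :=
  (Tor (ModuleCat R) k).obj (ModuleCat.of R (R ⧸ I))

/-- The `R`-module `Ext_R^k(M, N)`. -/
def ExtM (R : Type) [CommRing R] (k : ℕ) (M N : Type)
    [AddCommGroup M] [Module R M] [AddCommGroup N] [Module R N] : ModuleCat R :=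
  ((Ext R (ModuleCat R) k).obj (Opposite.op (ModuleCat.of R M))).obj (ModuleCat.of R N)

end


noncomputable section splice
open Limits
universe v u
variable {C : Type u} [Category.{v} C] [Abelian C]

def pi0 {N : C} (P : ProjectiveResolution N) : P.complex.X 0 ⟶ N := P.π.f 0

theorem pi0_epi {N : C} (P : ProjectiveResolution N) : Epi (pi0 P) :=
  inferInstanceAs (Epi (P.π.f 0))

theorem d_pi0 {N : C} (P : ProjectiveResolution N) : P.complex.d 1 0 ≫ pi0 P = 0 :=
  P.complex_d_comp_π_f_zero

theorem exact_pi0 {N : C} (P : ProjectiveResolution N) :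
    (ShortComplex.mk _ _ (d_pi0 P)).Exact := P.exact₀

def spliceMap {N F : C} (i : N ⟶ F) (P : ProjectiveResolution N) : P.complex.X 0 ⟶ F :=
  pi0 P ≫ i

theorem spliceMap_w {N F : C} (i : N ⟶ F) (P : ProjectiveResolution N) :
    P.complex.d 1 0 ≫ spliceMap i P = 0 := by
  unfold spliceMap
  rw [← Category.assoc, d_pi0, Limits.zero_comp]

theorem spliceMap_zero {N F Y : C} (i : N ⟶ F) (P : ProjectiveResolution N) (g : F ⟶ Y)
    (h : i ≫ g = 0) : spliceMap i P ≫ g = 0 := by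
  unfold spliceMap
  rw [Category.assoc, h, Limits.comp_zero]

def spliceCx {N F : C} (i : N ⟶ F) (P : ProjectiveResolution N) : ChainComplex C ℕ :=
  ChainComplex.augment P.complex (spliceMap i P) (spliceMap_w i P)

theorem splice_exact {N F : C} (i : N ⟶ F) [Mono i] (P : ProjectiveResolution N) (n : ℕ) :
    (spliceCx i P).ExactAt (n + 1) := by
  rw [HomologicalComplex.exactAt_iff' _ (n + 1 + 1) (n + 1) n (by simp) (by simp)]
  match n with
  | 0 =>
    have h := exact_pi0 P
    let S1 := ShortComplex.mk _ _ (d_pi0 P)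
    let S2 := ShortComplex.mk _ _ (spliceMap_w i P)
    let φ : S1 ⟶ S2 := { τ₁ := 𝟙 _, τ₂ := 𝟙 _, τ₃ := i, comm₁₂ := by simp [S1, S2], comm₂₃ := by
                          simp [S1, S2, spliceMap] }
    have : Epi φ.τ₁ := by dsimp [φ]; infer_instance
    have : IsIso φ.τ₂ := by dsimp [φ]; infer_instance
    have : Mono φ.τ₃ := ‹Mono i›
    exact (ShortComplex.exact_iff_of_epi_of_isIso_of_mono φ).1 h
  | n + 1 => exact P.exact_succ n

def splice (S : ShortComplex C) (hS : S.ShortExact) [Projective S.X₂]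
    (P : ProjectiveResolution S.X₁) : ProjectiveResolution S.X₃ where
  complex := spliceCx S.f P
  projective n := by
    cases n with
    | zero => exact (inferInstance : Projective S.X₂)
    | succ n => exact P.projective n
  π := (ChainComplex.toSingle₀Equiv _ _).symm ⟨S.g, by
    change spliceMap S.f P ≫ S.g = 0
    simp [spliceMap]⟩
  quasiIso := ⟨fun n => by
    have := hS.epi_g
    have := hS.mono_f
    cases n with
    | zero =>
      rw [ChainComplex.quasiIsoAt₀_iff, ShortComplex.quasiIso_iff_of_zeros']
      · have hw : spliceMap S.f P ≫ S.g = 0 := by simp [spliceMap]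
        let S1 := ShortComplex.mk _ _ hw
        let φ : S1 ⟶ S := { τ₁ := pi0 P, τ₂ := 𝟙 _, τ₃ := 𝟙 _, comm₁₂ := by simp [S1, spliceMap], comm₂₃ := by simp [S1] }
        have : Epi φ.τ₁ := pi0_epi P
        have : IsIso φ.τ₂ := by dsimp [φ]; infer_instance
        have : Mono φ.τ₃ := by dsimp [φ]; infer_instance
        have h1 : S1.Exact := (ShortComplex.exact_iff_of_epi_of_isIso_of_mono φ).2 hS.exact
        refine (ShortComplex.exact_and_epi_g_iff_of_iso (S₂ := S1) ?_).2 ⟨h1, by dsimp [S1]; infer_instance⟩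
        refine ShortComplex.isoMk (Iso.refl _) (Iso.refl _) (Iso.refl _) ?_ ?_
        · dsimp [S1]; erw [Category.id_comp, Category.comp_id]; rfl
        · dsimp [S1]; erw [Category.id_comp, Category.comp_id]
          exact (ChainComplex.toSingle₀Equiv_symm_apply_f_zero
            (C := spliceCx S.f P) (X := S.X₃) S.g hw).symm
      all_goals rfl
    | succ n =>
      rw [quasiIsoAt_iff_exactAt']
      · exact splice_exact S.f P n
      · apply ChainComplex.exactAt_succ_single_obj⟩

end splice

/-- resolution which is minimal up to degree k -/
def ResMin {R : Type} [CommRing R] (I : Ideal R) (k : ℕ) (M : ModuleCat.{0} R) : Prop :=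
  ∃ P : ProjectiveResolution M, ∀ i < k, Module.Finite R (P.complex.X i) ∧
    Module.Free R (P.complex.X i) ∧
    ∀ g : P.complex.X i ⟶ ModuleCat.of R (R ⧸ I), P.complex.d (i+1) i ≫ g = 0

theorem resMin_zero {R : Type} [CommRing R] (I : Ideal R) (M : ModuleCat.{0} R) :
    ResMin I 0 M := ⟨ProjectiveResolution.of M, by simp⟩

theorem resMin_succ {R : Type} [CommRing R] (I : Ideal R) (k : ℕ) 
    {M F : Type} [AddCommGroup M] [Module R M] [AddCommGroup F] [Module R F]
    [Module.Finite R F] [Module.Free R F] (f : F →ₗ[R] M) (hf : Function.Surjective f)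
    (hk : LinearMap.ker f ≤ I • ⊤)
    (h : ResMin I k (ModuleCat.of R (LinearMap.ker f))) : ResMin I (k+1) (ModuleCat.of R M) := by
  obtain ⟨P, hP⟩ := h
  let S : ShortComplex (ModuleCat.{0} R) := ShortComplex.mk (ModuleCat.ofHom (LinearMap.ker f).subtype)
    (ModuleCat.ofHom f) (by ext x; exact x.2)
  have hS : S.ShortExact := 
    { exact := by
        rw [ShortComplex.moduleCat_exact_iff]
        intro x hx
        exact ⟨⟨x, hx⟩, rfl⟩
      mono_f := by
        rw [ModuleCat.mono_iff_injective]
        exact Subtype.val_injective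
      epi_g := by
        rw [ModuleCat.epi_iff_surjective]
        exact hf }
  have : Projective S.X₂ := inferInstanceAs (Projective (ModuleCat.of R F))
  refine ⟨splice S hS P, ?_⟩
  intro i hi
  cases i with
  | zero =>
    refine ⟨inferInstanceAs (Module.Finite R F), inferInstanceAs (Module.Free R F), ?_⟩
    intro g
    change spliceMap S.f P ≫ g = 0
    have : S.f ≫ g = 0 := by
      ext x
      have hx : (x : LinearMap.ker f).1 ∈ I • (⊤ : Submodule R F) := hk x.2
      change g.hom (x : LinearMap.ker f).1 = 0
      let g' : F →ₗ[R] (R ⧸ I) := g.hom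
      change g' (x : LinearMap.ker f).1 = 0
      generalize (x : LinearMap.ker f).1 = y at hx
      refine Submodule.smul_induction_on hx ?_ ?_
      · intro r hr n _
        rw [map_smul]
        obtain ⟨z, hz⟩ := Ideal.Quotient.mk_surjective (g' n)
        rw [← hz]
        change Ideal.Quotient.mk I (r * z) = 0
        exact Ideal.Quotient.eq_zero_iff_mem.2 (I.mul_mem_right _ hr)
      · intro a b ha hb
        rw [map_add, ha, hb, add_zero]
    exact spliceMap_zero S.f P _ this
  | succ i => exact hP i (by omega)

theorem resMin_ext {R : Type} [CommRing R] (I : Ideal R) (k : ℕ)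
    {M : Type} [AddCommGroup M] [Module R M]
    (h : ResMin I (k+1) (ModuleCat.of R M)) :
    ∃ (ι : Type) (_ : Finite ι), Nonempty (ExtM R k M (R ⧸ I) ≃ₗ[R] (ι → R ⧸ I)) := by
  obtain ⟨P, hP⟩ := h
  let Y := ModuleCat.of R (R ⧸ I)
  let K := P.complex.linearYonedaObj R Y
  have hd : ∀ i < k + 1, ∀ j, K.d i j = 0 := by
    intro i hi j
    by_cases hj : i + 1 = j
    · subst hj
      ext (g : P.complex.X i ⟶ Y)
      exact (hP i hi).2.2 g
    · exact K.shape _ _ hj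
  have e1 : ExtM R k M (R ⧸ I) ≅ K.homology k := P.isoExt k Y
  have e2 : K.homology k ≅ K.X k := by
    refine (ShortComplex.HomologyData.ofZeros (K.sc k) ?_ ?_).left.homologyIso
    · change K.d _ _ = 0
      cases k with
      | zero => 
        apply K.shape; simp
      | succ k =>
        apply hd
        simp
    · change K.d _ _ = 0
      exact hd k (by omega) _
  obtain ⟨h1, h2, -⟩ := hP k (by omega)
  let b := Module.Free.chooseBasis R (P.complex.X k)
  refine ⟨Module.Free.ChooseBasisIndex R (P.complex.X k), inferInstance, ⟨?_⟩⟩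
  have e3 : (K.X k) ≃ₗ[R] (P.complex.X k →ₗ[R] (R ⧸ I)) :=
    (ModuleCat.homLinearEquiv (S := R) : (P.complex.X k ⟶ Y) ≃ₗ[R] _)
  exact (e1 ≪≫ e2).toLinearEquiv ≪≫ₗ e3 ≪≫ₗ (b.constr R).symm

theorem free_of_resMin {R : Type} [CommRing R] (I : Ideal R) (k : ℕ)
    {M : Type} [AddCommGroup M] [Module R M]
    (h : ResMin I (k+1) (ModuleCat.of R M))
    [Module (R ⧸ I) (ExtM R k M (R ⧸ I))]
    [IsScalarTower R (R ⧸ I) (ExtM R k M (R ⧸ I))] :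
    Module.Free (R ⧸ I) (ExtM R k M (R ⧸ I)) := by
  obtain ⟨ι, _, ⟨e⟩⟩ := resMin_ext I k h
  exact Module.Free.of_equiv
    (e.extendScalarsOfSurjective (S := R ⧸ I) Ideal.Quotient.mk_surjective).symm

/-- linearity predicate -/
def Lin {R : Type} [CommRing R] (I : Ideal R) : ℕ → ∀ (M : Type) [AddCommGroup M] [Module R M],
    Submodule R M → Prop
  | 0, _, _, _, _ => True
  | k + 1, M, _, _, M' => ∃ (F : Type) (_ : AddCommGroup F) (_ : Module R F)
      (_ : Module.Finite R F) (_ : Module.Free R F) (f : F →ₗ[R] M),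
      Function.Surjective f ∧ M'.comap f ≤ I • ⊤ ∧
      Lin I k (LinearMap.ker f) ((I ^ 2 • (⊤ : Submodule R F)).comap (LinearMap.ker f).subtype)

theorem Lin.resMin {R : Type} [CommRing R] (I : Ideal R) (k : ℕ) :
    ∀ (M : Type) [AddCommGroup M] [Module R M] (M' : Submodule R M), Lin I k M M' →
      ResMin I k (ModuleCat.of R M) := by
  induction k with
  | zero => intro M _ _ M' _; exact resMin_zero I _
  | succ k ih =>
    intro M _ _ M' h
    obtain ⟨F, _, _, _, _, f, hf, h1, h2⟩ := h
    refine resMin_succ I k f hf (le_trans ?_ h1) (ih _ _ h2)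
    intro x hx
    have : f x = 0 := hx
    simp [this]

theorem smul_top_map {R : Type} [CommRing R] (I : Ideal R) {A B : Type} [AddCommGroup A]
    [Module R A] [AddCommGroup B] [Module R B] (f : A →ₗ[R] B) {x : A}
    (hx : x ∈ I • (⊤ : Submodule R A)) : f x ∈ I • (⊤ : Submodule R B) := by
  have h : f x ∈ (I • (⊤ : Submodule R A)).map f := Submodule.mem_map_of_mem hx
  rw [Submodule.map_smul''] at h
  exact Submodule.smul_mono le_rfl le_top h

theorem Lin.ext {R : Type} [CommRing R] (I : Ideal R) (k : ℕ) :
    ∀ (A B C : Type) [AddCommGroup A] [Module R A] [AddCommGroup B] [Module R B]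
      [AddCommGroup C] [Module R C] (i : A →ₗ[R] B) (p : B →ₗ[R] C) (A' : Submodule R A)
      (B' : Submodule R B) (C' : Submodule R C), Function.Injective i → Function.Surjective p →
      Function.Exact i p → B'.comap i ≤ A' → B' ≤ C'.comap p → I • ⊤ ≤ B' →
      Lin I k A A' → Lin I k C C' → Lin I k B B' := by
  induction k with
  | zero => intros; trivial
  | succ k ih =>
    intro A B C _ _ _ _ _ _ i p A' B' C' hi hp hex hA hC hB hLA hLC
    obtain ⟨FA, _, _, _, _, f, hf, hf1, hf2⟩ := hLA
    obtain ⟨FC, _, _, _, _, g, hg, hg1, hg2⟩ := hLC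
    obtain ⟨φ, hφ⟩ := Module.projective_lifting_property p g hp
    have hφ' : ∀ c, p (φ c) = g c := fun c => LinearMap.congr_fun hφ c
    have hpi : ∀ a, p (i a) = 0 := fun a => hex.apply_apply_eq_zero a
    let h : FA × FC →ₗ[R] B := (i.comp f).coprod φ
    have hh : ∀ a c, h (a, c) = i (f a) + φ c := fun a c => by simp [h]
    have hsurj : Function.Surjective h := by
      intro b
      obtain ⟨c, hc⟩ := hg (p b)
      obtain ⟨a, ha⟩ := (hex (b - φ c)).1 (by rw [map_sub, hφ', hc, sub_self])
      obtain ⟨a, rfl⟩ := hf a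
      exact ⟨(a, c), by rw [hh, ha]; abel⟩
    have hle : B'.comap h ≤ I • ⊤ := by
      rintro ⟨a, c⟩ hac
      have hac : h (a, c) ∈ B' := hac
      rw [hh] at hac
      have hc : c ∈ I • (⊤ : Submodule R FC) := by
        apply hg1
        have := hC hac
        simpa [hpi, hφ'] using this
      have ha : a ∈ I • (⊤ : Submodule R FA) := by
        apply hf1
        apply hA
        have h2 := hB (smul_top_map I φ hc)
        simpa using B'.sub_mem hac h2
      have := Submodule.add_mem _ (smul_top_map I (LinearMap.inl R FA FC) ha)
        (smul_top_map I (LinearMap.inr R FA FC) hc)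
      simpa using this
    have hker : LinearMap.ker h ≤ I • ⊤ := le_trans (by
      intro x hx
      have : h x = 0 := hx
      simp [this]) hle
    refine ⟨FA × FC, inferInstance, inferInstance, inferInstance, inferInstance, h, hsurj, hle, ?_⟩
    let i' : LinearMap.ker f →ₗ[R] LinearMap.ker h :=
      (LinearMap.inl R FA FC).restrict (fun x hx => by
        have hx : f x = 0 := hx
        simp [hh, hx])
    let p' : LinearMap.ker h →ₗ[R] LinearMap.ker g :=
      (LinearMap.snd R FA FC).restrict (fun x hx => by
        obtain ⟨a, c⟩ := x
        have hx : h (a, c) = 0 := hx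
        rw [hh] at hx
        have := congrArg p hx
        simpa [hpi, hφ'] using this)
    refine ih _ _ _ i' p' _ _ _ ?_ ?_ ?_ ?_ ?_ ?_ hf2 hg2
    · rintro ⟨x, hx⟩ ⟨y, hy⟩ hxy
      have := congrArg (fun z => z.1.1) hxy
      exact Subtype.ext this
    · rintro ⟨c, hc⟩
      have hc : g c = 0 := hc
      obtain ⟨a, ha⟩ := (hex (φ c)).1 (by rw [hφ', hc])
      obtain ⟨a, rfl⟩ := hf a
      exact ⟨⟨(-a, c), by simp [hh, ha]⟩, rfl⟩
    · rintro ⟨⟨a, c⟩, hx⟩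
      constructor
      · intro h0
        have h0 : c = 0 := congrArg Subtype.val h0
        subst h0
        have hx : h (a, 0) = 0 := hx
        rw [hh, map_zero, add_zero] at hx
        exact ⟨⟨a, hi (by simpa using hx)⟩, rfl⟩
      · rintro ⟨a', ha'⟩
        have := congrArg (fun z => z.1.2) ha'
        exact Subtype.ext this.symm
    · rintro ⟨a, ha⟩ h1
      exact smul_top_map (I ^ 2) (LinearMap.fst R FA FC) h1
    · rintro ⟨a, ha⟩ h1
      exact smul_top_map (I ^ 2) (LinearMap.snd R FA FC) h1
    · rw [Submodule.smul_le]
      rintro r hr ⟨x, hx⟩ -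
      have := Submodule.smul_mem_smul hr (hker hx)
      rw [← Submodule.mul_smul, ← pow_two] at this
      exact this

/-- linearity for ideals -/
def LinI {R : Type} [CommRing R] (I : Ideal R) (k t : ℕ) (J : Ideal R) : Prop :=
  Lin I k J (Submodule.comap J.subtype (I ^ t))

theorem LinI.bot {R : Type} [CommRing R] (I : Ideal R) (k t : ℕ) : LinI I k t ⊥ := by
  have : ∀ (M : Type) [AddCommGroup M] [Module R M] [Subsingleton M] (M' : Submodule R M),
      Lin I k M M' := by
    induction k with
    | zero => intros; trivial
    | succ k ih =>
      intro M _ _ _ M'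
      refine ⟨PUnit, inferInstance, inferInstance, inferInstance, inferInstance, 0, ?_, ?_, ih _ _⟩
      · intro x; exact ⟨0, Subsingleton.elim _ _⟩
      · intro x _
        rw [Subsingleton.elim x 0]; exact Submodule.zero_mem _
  exact this _ _

theorem LinI.step {R : Type} [CommRing R] (I : Ideal R) (k s : ℕ) (J A : Ideal R) (u : R)
    (hA : ∀ c, c * u ∈ J ↔ c ∈ A) (hu : ∀ c, c * u ∈ J ⊔ I ^ (s + 1) → c ∈ I)
    (hJ : J ≤ I ^ s) (hus : u ∈ I ^ s)
    (h1 : LinI I k 2 A) (h2 : LinI I (k + 1) (s + 1) J) :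
    LinI I (k + 1) (s + 1) (J ⊔ Ideal.span {u}) := by
  set J2 := J ⊔ Ideal.span {u} with hJ2
  have hle : J ≤ J2 := le_sup_left
  have huJ : u ∈ J2 := (le_sup_right : _ ≤ J2) (Ideal.mem_span_singleton_self u)
  have hJ2s : J2 ≤ I ^ s := sup_le hJ ((Ideal.span_singleton_le_iff_mem _).2 hus)
  let Q := LinearMap.range (Submodule.inclusion hle)
  let C' : Submodule R (J2 ⧸ Q) := (Submodule.comap J2.subtype (I ^ (s + 1))).map Q.mkQ
  refine Lin.ext I (k + 1) J J2 (J2 ⧸ Q) (Submodule.inclusion hle) Q.mkQ _ _ C'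
    (Submodule.inclusion_injective hle) Q.mkQ_surjective ?_ le_rfl (Submodule.le_comap_map _ _) ?_
    h2 ?_
  · rw [LinearMap.exact_iff, Submodule.ker_mkQ]
  · rw [Submodule.smul_le]
    rintro r hr ⟨x, hx⟩ -
    change r * x ∈ I ^ (s + 1)
    rw [pow_succ']
    exact Ideal.mul_mem_mul hr (hJ2s hx)
  · let f : R →ₗ[R] (J2 ⧸ Q) := Q.mkQ.comp (LinearMap.toSpanSingleton R J2 ⟨u, huJ⟩)
    have hf : ∀ c (y : R) (hy : y ∈ J2), f c = Q.mkQ ⟨y, hy⟩ → c * u - y ∈ J := by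
      intro c y hy h
      have : Q.mkQ (c • ⟨u, huJ⟩) = Q.mkQ ⟨y, hy⟩ := h
      rw [← sub_eq_zero, ← map_sub, Submodule.mkQ_apply, Submodule.Quotient.mk_eq_zero] at this
      obtain ⟨⟨z, hz⟩, hz'⟩ := this
      have := congrArg Subtype.val hz'
      have this : z = c * u - y := this
      rw [← this]; exact hz
    have hker : LinearMap.ker f = A := by
      ext c
      rw [← hA]
      constructor
      · intro hc
        have hc : f c = 0 := hc
        simpa using hf c 0 (Submodule.zero_mem _) (by rw [hc]; exact (map_zero Q.mkQ).symm)
      · intro hc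
        change Q.mkQ (c • ⟨u, huJ⟩) = 0
        rw [Submodule.mkQ_apply, Submodule.Quotient.mk_eq_zero]
        exact ⟨⟨c * u, hc⟩, rfl⟩
    refine ⟨R, inferInstance, inferInstance, inferInstance, inferInstance, f, ?_, ?_, ?_⟩
    · intro y
      obtain ⟨⟨y, hy⟩, rfl⟩ := Q.mkQ_surjective y
      obtain ⟨j, hj, w, hw, rfl⟩ := Submodule.mem_sup.1 hy
      obtain ⟨c, rfl⟩ := Ideal.mem_span_singleton'.1 hw
      refine ⟨c, ?_⟩
      change Q.mkQ (c • ⟨u, huJ⟩) = _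
      rw [← sub_eq_zero, ← map_sub, Submodule.mkQ_apply, Submodule.Quotient.mk_eq_zero]
      refine ⟨⟨-j, J.neg_mem hj⟩, Subtype.ext ?_⟩
      change -j = c * u - (j + c * u)
      ring
    · rintro c ⟨⟨y, hy⟩, hy', hc⟩
      have := hf c y hy hc.symm
      have hcI : c ∈ I := hu c (by
        have h3 : c * u = (c * u - y) + y := by ring
        rw [h3]
        exact Submodule.add_mem_sup this hy')
      simpa using hcI
    · have key : ∀ N : Submodule R R, N = A →
          Lin I k N ((I ^ 2 • (⊤ : Submodule R R)).comap N.subtype) := by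
        rintro N rfl
        have e : (I ^ 2 • (⊤ : Submodule R R)) = I ^ 2 := by simp
        rw [e]; exact h1
      exact key _ hker

section lists
variable {R : Type} [CommRing R]

def WReg : List R → Prop
  | [] => True
  | x :: rs => WReg rs ∧ ∀ c, x * c ∈ Ideal.ofList rs → c ∈ Ideal.ofList rs

def mons : List R → ℕ → List R
  | _, 0 => [1]
  | [], _ + 1 => []
  | x :: rs, s + 1 => mons rs (s + 1) ++ (mons (x :: rs) s).map (x * ·)

theorem mons_zero (rs : List R) : mons rs 0 = [1] := by cases rs <;> simp [mons]

def dot : (ℕ → R) → List R → R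
  | _, [] => 0
  | c, u :: L => c 0 * u + dot (fun i => c (i + 1)) L

theorem dot_append (L1 L2 : List R) : ∀ c, dot c (L1 ++ L2) =
    dot c L1 + dot (fun i => c (i + L1.length)) L2 := by
  induction L1 with
  | nil => intro c; simp [dot]
  | cons u L ih =>
    intro c
    simp only [List.cons_append, dot, ih, List.length_cons]
    rw [add_assoc]; rfl

theorem dot_congr (L : List R) : ∀ c d : ℕ → R, (∀ i < L.length, c i = d i) →
    dot c L = dot d L := by
  induction L with
  | nil => intros; rfl
  | cons u L ih =>
    intro c d h
    simp only [dot]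
    rw [h 0 (by simp), ih _ (fun i => d (i + 1)) (fun i hi => h _ (by simpa using hi))]

theorem dot_lin (x : R) (L : List R) : ∀ c d : ℕ → R, dot (fun i => c i + x * d i) L =
    dot c L + x * dot d L := by
  induction L with
  | nil => intros; simp [dot]
  | cons u L ih =>
    intro c d
    simp only [dot]
    rw [ih (fun i => c (i + 1)) (fun i => d (i + 1))]; ring

theorem dot_zero (L : List R) : dot (fun _ => 0) L = 0 := by
  induction L with
  | nil => rfl
  | cons u L ih => simp [dot, ih]

theorem dot_map (x : R) (L : List R) : ∀ c, dot c (L.map (x * ·)) = x * dot c L := by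
  induction L with
  | nil => intros; simp [dot]
  | cons u L ih => intro c; simp only [List.map_cons, dot, ih]; ring

theorem dot_mem (A K : Ideal R) (L : List R) : ∀ c : ℕ → R, (∀ i < L.length, c i ∈ A) →
    (∀ u ∈ L, u ∈ K) → dot c L ∈ A * K := by
  induction L with
  | nil => intros; exact Submodule.zero_mem _
  | cons u L ih =>
    intro c hc hL
    exact Ideal.add_mem _ (Ideal.mul_mem_mul (hc 0 (by simp)) (hL u (by simp)))
      (ih _ (fun i hi => hc _ (by simpa using hi)) (fun v hv => hL v (by simp [hv])))

theorem mem_ofList' (L : List R) : ∀ y, y ∈ Ideal.ofList L → ∃ c, dot c L = y := by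
  induction L with
  | nil => intro y hy; exact ⟨0, by simpa [dot, eq_comm] using hy⟩
  | cons u L ih =>
    intro y hy
    rw [Ideal.ofList_cons] at hy
    obtain ⟨a, ha, b, hb, rfl⟩ := Submodule.mem_sup.1 hy
    obtain ⟨c, rfl⟩ := Ideal.mem_span_singleton'.1 ha
    obtain ⟨d, rfl⟩ := ih b hb
    exact ⟨fun i => Nat.casesOn i c d, rfl⟩

theorem mem_ofList_of_mem (L : List R) (u : R) (hu : u ∈ L) : u ∈ Ideal.ofList L :=
  Ideal.subset_span hu

theorem dot_mem_ofList (L : List R) (c : ℕ → R) : dot c L ∈ Ideal.ofList L := by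
  have := dot_mem ⊤ (Ideal.ofList L) L c (by simp) (mem_ofList_of_mem L)
  simpa using this

theorem ofList_map_mul (x : R) (L : List R) :
    Ideal.ofList (L.map (x * ·)) = Ideal.span {x} * Ideal.ofList L := by
  induction L with
  | nil => simp
  | cons u L ih =>
    rw [List.map_cons, Ideal.ofList_cons, ih, Ideal.ofList_cons, Ideal.mul_sup,
      Ideal.span_singleton_mul_span_singleton]

theorem sup_pow_succ (A X : Ideal R) (s : ℕ) :
    (A ⊔ X) ^ (s + 1) = A ^ (s + 1) ⊔ X * (A ⊔ X) ^ s := by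
  apply le_antisymm
  · induction s with
    | zero => simp
    | succ s ih =>
      rw [pow_succ' (A ⊔ X) (s + 1), Ideal.sup_mul]
      refine sup_le ?_ le_sup_right
      refine (Ideal.mul_mono_right ih).trans ?_
      rw [Ideal.mul_sup]
      refine sup_le ?_ ?_
      · rw [← pow_succ']; exact le_sup_left
      · refine le_trans ?_ le_sup_right
        rw [mul_left_comm]
        refine Ideal.mul_mono_right ?_
        rw [pow_succ']
        exact Ideal.mul_mono_left le_sup_left
  · refine sup_le (Ideal.pow_right_mono le_sup_left _) ?_
    rw [pow_succ']
    exact Ideal.mul_mono_left le_sup_right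

theorem ofList_cons_pow (x : R) (rs : List R) (s : ℕ) :
    Ideal.ofList (x :: rs) ^ (s + 1) =
      Ideal.ofList rs ^ (s + 1) ⊔ Ideal.span {x} * Ideal.ofList (x :: rs) ^ s := by
  rw [Ideal.ofList_cons, sup_comm, sup_pow_succ]

theorem ofList_mons (rs : List R) : ∀ s, Ideal.ofList (mons rs s) = Ideal.ofList rs ^ s := by
  induction rs with
  | nil =>
    intro s
    cases s with
    | zero => simp [mons]
    | succ s => simp [mons]
  | cons x rs ih =>
    intro s
    induction s with
    | zero => simp [mons]
    | succ s ih2 =>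
      rw [mons, Ideal.ofList_append, ih, ofList_map_mul, ih2, ofList_cons_pow]

def FI (A K : Ideal R) (L : List R) : Prop :=
  ∀ c : ℕ → R, dot c L ∈ K → ∀ i < L.length, c i ∈ A

theorem nzd_pow (A : Ideal R) (x : R) (hx : ∀ c, x * c ∈ A → c ∈ A) (L : ℕ → List R)
    (hL : ∀ s, Ideal.ofList (L s) = A ^ s) (hF : ∀ s, FI A (A ^ (s + 1)) (L s)) (t : ℕ) :
    ∀ b, x * b ∈ A ^ t → b ∈ A ^ t := by
  induction t with
  | zero => simp
  | succ t ih =>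
    intro b hb
    have h1 := ih b (Ideal.pow_le_pow_right (Nat.le_succ t) hb)
    rw [← hL] at h1
    obtain ⟨c, rfl⟩ := mem_ofList' _ _ h1
    have h2 : dot (fun i => 0 + x * c i) (L t) = x * dot c (L t) := by
      rw [dot_lin, dot_zero, zero_add]
    rw [← h2] at hb
    have h3 := hF t _ hb
    rw [pow_succ']
    refine dot_mem _ _ _ _ (fun i hi => hx _ (by simpa using h3 i hi)) ?_
    intro u hu
    rw [← hL]; exact mem_ofList_of_mem _ _ hu

theorem FI_mons (rs : List R) : WReg rs → ∀ s, FI (Ideal.ofList rs) (Ideal.ofList rs ^ (s + 1))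
    (mons rs s) := by
  have h0 : ∀ rs : List R, FI (Ideal.ofList rs) (Ideal.ofList rs ^ (0 + 1)) (mons rs 0) := by
    intro rs c hc i hi
    rw [mons_zero] at hc hi
    have : i = 0 := by simpa using hi
    subst this
    simpa [dot] using hc
  induction rs with
  | nil =>
    intro _ s
    cases s with
    | zero => exact h0 _
    | succ s => intro c _ i hi; simp [mons] at hi
  | cons x rs ih =>
    intro hW s
    have hF := ih hW.1
    have hz := nzd_pow _ x hW.2 (mons rs) (ofList_mons rs) hF
    have hAB : Ideal.ofList rs ≤ Ideal.ofList (x :: rs) := by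
      rw [Ideal.ofList_cons]; exact le_sup_right
    have hxB : x ∈ Ideal.ofList (x :: rs) := mem_ofList_of_mem _ _ (by simp)
    induction s with
    | zero => exact h0 _
    | succ s ih2 =>
      intro c hc i hi
      rw [mons, dot_append, dot_map, ofList_cons_pow] at hc
      obtain ⟨a, ha, w, hw, hEq⟩ := Submodule.mem_sup.1 hc
      obtain ⟨b, hb, rfl⟩ := Ideal.mem_span_singleton_mul.1 hw
      set G := dot c (mons rs (s + 1)) with hG
      set c2 : ℕ → R := fun i => c (i + (mons rs (s + 1)).length) with hc2
      set H := dot c2 (mons (x :: rs) s) with hH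
      have h1 : H - b ∈ Ideal.ofList rs ^ (s + 1) := by
        apply hz
        have : x * (H - b) = a - G := by linear_combination -hEq
        rw [this]
        refine Ideal.sub_mem _ (Ideal.pow_le_pow_right (Nat.le_succ _) ha) ?_
        rw [← ofList_mons]
        exact dot_mem_ofList _ _
      have h2 : H ∈ Ideal.ofList (x :: rs) ^ (s + 1) := by
        have := Ideal.add_mem _ (Ideal.pow_right_mono hAB _ h1) hb
        simpa using this
      by_cases hi2 : i < (mons rs (s + 1)).length
      · rw [← ofList_mons] at h1
        obtain ⟨d, hd⟩ := mem_ofList' _ _ h1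
        have h3 := hF (s + 1) (fun i => c i + x * d i) (by
          rw [dot_lin, hd, ← hG]
          have : G + x * (H - b) = a := by linear_combination -hEq
          rw [this]; exact ha) i hi2
        have h4 := Ideal.sub_mem _ (hAB h3) (Ideal.mul_mem_right (d i) _ hxB)
        simpa using h4
      · have h3 := ih2 c2 h2 (i - (mons rs (s + 1)).length) (by
          simp [mons] at hi; omega)
        simp only [hc2] at h3
        rwa [Nat.sub_add_cancel (by omega)] at h3

theorem FI.tri {A K : Ideal R} {pre post : List R} {u : R} (h : FI A K (pre ++ u :: post))
    (c : R) (hc : c * u ∈ K ⊔ Ideal.ofList pre) : c ∈ A := by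
  obtain ⟨k, hk, y, hy, hEq⟩ := Submodule.mem_sup.1 hc
  obtain ⟨d, rfl⟩ := mem_ofList' _ _ hy
  have := h (fun i => if i < pre.length then 0 + (-1) * d i else if i = pre.length then c else 0) (by
    rw [dot_append, dot_congr pre _ (fun i => 0 + (-1) * d i) (fun i hi => by simp [hi]), dot_lin,
      dot_zero, dot, dot_congr post _ (fun _ => 0) (fun i hi => by
        rw [if_neg (by omega), if_neg (by omega)]), dot_zero]
    have : 0 + -1 * dot d pre + ((if 0 + pre.length < pre.length then 0 + -1 * d (0 + pre.length) else
        if 0 + pre.length = pre.length then c else 0) * u + 0) = k := by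
      rw [if_neg (by omega), if_pos (by omega)]
      linear_combination -hEq
    rw [this]; exact hk) pre.length (by simp)
  simpa using this

def Chn (P : Ideal R → R → Prop) : Ideal R → List R → Prop
  | _, [] => True
  | K, u :: L => P K u ∧ Chn P (K ⊔ Ideal.span {u}) L

theorem Chn_append (P : Ideal R → R → Prop) (L1 L2 : List R) : ∀ K, Chn P K (L1 ++ L2) ↔
    Chn P K L1 ∧ Chn P (K ⊔ Ideal.ofList L1) L2 := by
  induction L1 with
  | nil => intro K; simp [Chn]
  | cons u L ih =>
    intro K
    rw [List.cons_append, Chn, Chn, ih, Ideal.ofList_cons, and_assoc, sup_assoc]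

theorem Chn_of (P : Ideal R → R → Prop) (L : List R) : ∀ K,
    (∀ pre u post, L = pre ++ u :: post → P (K ⊔ Ideal.ofList pre) u) → Chn P K L := by
  induction L with
  | nil => intros; trivial
  | cons u L ih =>
    intro K h
    refine ⟨by simpa using h [] u L rfl, ih _ ?_⟩
    intro pre v post hL
    have := h (u :: pre) v post (by rw [hL]; rfl)
    rwa [Ideal.ofList_cons, ← sup_assoc] at this

theorem Chn_mono {P P' : Ideal R → R → Prop} (h : ∀ K u, P K u → P' K u) (L : List R) : ∀ K,
    Chn P K L → Chn P' K L := by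
  induction L with
  | nil => intros; trivial
  | cons u L ih => intro K hK; exact ⟨h _ _ hK.1, ih _ hK.2⟩

def Colon (A : Ideal R) (J : Ideal R) (u : R) : Prop := ∀ c, c * u ∈ J ↔ c ∈ A

theorem Chn_map (A K : Ideal R) (x : R) (hx : ∀ b, x * b ∈ K → b ∈ K) (L : List R) : ∀ H,
    Chn (Colon A) (K ⊔ H) L → Chn (Colon A) (K ⊔ Ideal.span {x} * H) (L.map (x * ·)) := by
  induction L with
  | nil => intros; trivial
  | cons u L ih =>
    intro H hH
    rw [List.map_cons]
    refine ⟨?_, ?_⟩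
    · intro c
      rw [← hH.1 c]
      constructor
      · intro hc
        obtain ⟨k, hk, w, hw, hEq⟩ := Submodule.mem_sup.1 hc
        obtain ⟨h, hh, rfl⟩ := Ideal.mem_span_singleton_mul.1 hw
        have : c * u - h ∈ K := hx _ (by
          have : x * (c * u - h) = k := by linear_combination -hEq
          rw [this]; exact hk)
        have e : c * u = (c * u - h) + h := by ring
        rw [e]
        exact Submodule.add_mem_sup this hh
      · intro hc
        obtain ⟨k, hk, h, hh, hEq⟩ := Submodule.mem_sup.1 hc
        have e : c * (x * u) = x * k + x * h := by linear_combination -x * hEq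
        rw [e]
        exact Submodule.add_mem_sup (K.mul_mem_left _ hk)
          (Ideal.mul_mem_mul (Ideal.mem_span_singleton_self x) hh)
    · have := ih (H ⊔ Ideal.span {u}) (by rw [← sup_assoc]; exact hH.2)
      rwa [Ideal.mul_sup, Ideal.span_singleton_mul_span_singleton, ← sup_assoc] at this

theorem Chn_FI (A : Ideal R) (s : ℕ) (L : List R) (hL : Ideal.ofList L ≤ A ^ s)
    (h : FI A (A ^ (s + 1)) L) : Chn (Colon A) (A ^ (s + 1)) L := by
  apply Chn_of
  rintro pre u post rfl c
  constructor
  · exact h.tri c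
  · intro hc
    refine (le_sup_left : A ^ (s + 1) ≤ _) ?_
    rw [pow_succ']
    exact Ideal.mul_mem_mul hc (hL (mem_ofList_of_mem _ _ (by simp)))

theorem Chn_D (x : R) (rs : List R) (hW : WReg (x :: rs)) (s : ℕ) :
    Chn (Colon (Ideal.ofList rs)) (Ideal.ofList rs ^ (s + 1)) (mons (x :: rs) s) := by
  have hF := FI_mons rs hW.1
  have hz := nzd_pow _ x hW.2 (mons rs) (ofList_mons rs) hF
  induction s with
  | zero =>
    rw [mons_zero]
    exact ⟨fun c => by simp, trivial⟩
  | succ s ih =>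
    rw [mons, Chn_append]
    refine ⟨Chn_FI _ _ _ (ofList_mons rs _).le (hF _), ?_⟩
    rw [ofList_mons, sup_eq_right.2 (Ideal.pow_le_pow_right (Nat.le_succ _))]
    have := Chn_map (Ideal.ofList rs) (Ideal.ofList rs ^ (s + 1)) x (hz _) _ ⊥ (by simpa using ih)
    simpa using this

theorem Chn_C (rs : List R) : WReg rs → ∀ s,
    Chn (fun J u => ∃ rs', rs' <:+ rs ∧ Colon (Ideal.ofList rs') J u) ⊥ (mons rs s) := by
  induction rs with
  | nil =>
    intro _ s
    cases s with
    | zero => rw [mons_zero]; exact ⟨⟨[], by simp, fun c => by simp⟩, trivial⟩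
    | succ s => rw [mons]; trivial
  | cons x rs ih =>
    intro hW s
    cases s with
    | zero => rw [mons_zero]; exact ⟨⟨[], by simp, fun c => by simp⟩, trivial⟩
    | succ s =>
      have hz := nzd_pow _ x hW.2 (mons rs) (ofList_mons rs) (FI_mons rs hW.1)
      rw [mons, Chn_append]
      constructor
      · refine Chn_mono ?_ _ _ (ih hW.1 (s + 1))
        rintro K u ⟨rs', h, h'⟩
        exact ⟨rs', h.trans (List.suffix_cons _ _), h'⟩
      · rw [ofList_mons, bot_sup_eq]
        refine Chn_mono (P := Colon (Ideal.ofList rs)) ?_ _ _ ?_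
        · intro K u h; exact ⟨rs, List.suffix_cons _ _, h⟩
        · have := Chn_map (Ideal.ofList rs) (Ideal.ofList rs ^ (s + 1)) x (hz _) _ ⊥
            (by simpa using Chn_D x rs hW s)
          simpa using this

theorem WReg.suffix {rs RS : List R} (h : rs <:+ RS) (hW : WReg RS) : WReg rs := by
  induction RS with
  | nil => rw [List.suffix_nil.1 h]; trivial
  | cons x RS ih =>
    rcases List.suffix_cons_iff.1 h with rfl | h
    · exact hW
    · exact ih h hW.1

theorem mons_prefix {rs RS : List R} (h : rs <:+ RS) (s : ℕ) : mons rs s <+: mons RS s := by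
  cases s with
  | zero => rw [mons_zero, mons_zero]
  | succ s =>
    induction RS with
    | nil => rw [List.suffix_nil.1 h]
    | cons x RS ih =>
      rcases List.suffix_cons_iff.1 h with rfl | h
      · exact List.prefix_rfl
      · rw [mons]
        exact (ih h).trans (List.prefix_append _ _)

theorem linI_chain (RS : List R) (hW : WReg RS) (k s : ℕ)
    (hk : ∀ rs', rs' <:+ RS → LinI (Ideal.ofList RS) k 2 (Ideal.ofList rs')) (L : List R) :
    ∀ pre, (pre ++ L) <+: mons RS s →
      Chn (fun J u => ∃ rs', rs' <:+ RS ∧ Colon (Ideal.ofList rs') J u) (Ideal.ofList pre) L →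
      LinI (Ideal.ofList RS) (k + 1) (s + 1) (Ideal.ofList pre) →
      LinI (Ideal.ofList RS) (k + 1) (s + 1) (Ideal.ofList (pre ++ L)) := by
  induction L with
  | nil => intro pre _ _ h; simpa using h
  | cons u L ih =>
    intro pre hpre hC hpL
    obtain ⟨⟨rs', hrs', hcol⟩, hC⟩ := hC
    have e : pre ++ u :: L = (pre ++ [u]) ++ L := by simp
    have e2 : Ideal.ofList (pre ++ [u]) = Ideal.ofList pre ⊔ Ideal.span {u} := by
      simp [Ideal.ofList_append]
    obtain ⟨post, hpost⟩ := id hpre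
    have hmem : ∀ v ∈ pre ++ u :: L, v ∈ Ideal.ofList RS ^ s := by
      intro v hv
      rw [← ofList_mons]
      exact mem_ofList_of_mem _ _ (hpre.subset hv)
    rw [e]
    apply ih
    · rwa [← e]
    · rwa [e2]
    · rw [e2]
      refine LinI.step _ k s _ _ u hcol ?_ ?_ (hmem u (by simp)) (hk rs' hrs') hpL
      · have hF := FI_mons RS hW s
        rw [← hpost, List.append_assoc, List.cons_append] at hF
        intro c hc
        rw [sup_comm] at hc
        exact hF.tri c hc
      · refine Ideal.span_le.2 ?_
        intro v hv
        exact hmem v (List.mem_append_left _ hv)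

theorem linI_main (RS : List R) (hW : WReg RS) (k : ℕ) : ∀ rs, rs <:+ RS → ∀ s,
    LinI (Ideal.ofList RS) k (s + 1) (Ideal.ofList rs ^ s) := by
  induction k with
  | zero => intros; trivial
  | succ k ih =>
    intro rs hrs s
    have := linI_chain RS hW k s (fun rs' h => by simpa using ih rs' h 1) (mons rs s) []
      (by simpa using mons_prefix hrs s) (by
        rw [Ideal.ofList_nil]
        refine Chn_mono ?_ _ _ (Chn_C rs (hW.suffix hrs) s)
        rintro K u ⟨rs', h, h'⟩
        exact ⟨rs', h.trans hrs, h'⟩) (by rw [Ideal.ofList_nil]; exact LinI.bot _ _ _)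
    rwa [List.nil_append, ofList_mons] at this

theorem wReg_of (L : List R) : RingTheory.Sequence.IsWeaklyRegular R L.reverse → WReg L := by
  induction L with
  | nil => intro _; trivial
  | cons x L ih =>
    intro h
    rw [List.reverse_cons, RingTheory.Sequence.isWeaklyRegular_append_iff] at h
    refine ⟨ih h.1, ?_⟩
    have h2 := ((RingTheory.Sequence.isWeaklyRegular_cons_iff _ _ _).1 h.2).1
    rw [isSMulRegular_quotient_iff_mem_of_smul_mem] at h2
    have e : Ideal.ofList L.reverse • (⊤ : Submodule R R) = Ideal.ofList L := by
      have : Ideal.ofList L.reverse = Ideal.ofList L := by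
        unfold Ideal.ofList
        congr 1
        ext x
        simp
      simp [this]
    rw [e] at h2
    exact h2

end lists

theorem stmt_13 (R : Type) [CommRing R] {n : ℕ} (r : Fin n → R)
    (hreg : RingTheory.Sequence.IsRegular R (List.ofFn r))
    (I : Ideal R) (hI : I = Ideal.span (Set.range r)) (s : ℕ) (hs : 1 ≤ s) (k : ℕ)
    [Module (R ⧸ I) (ExtM R k ↥(I ^ s) (R ⧸ I))]
    [IsScalarTower R (R ⧸ I) (ExtM R k ↥(I ^ s) (R ⧸ I))] :
    Module.Free (R ⧸ I) (ExtM R k ↥(I ^ s) (R ⧸ I)) := by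
  have hW : WReg (List.ofFn r).reverse := wReg_of _ (by
    rw [List.reverse_reverse]; exact hreg.toIsWeaklyRegular)
  have hI' : Ideal.ofList (List.ofFn r).reverse = I := by
    rw [hI, Ideal.ofList]
    congr 1
    ext x
    simp
  have h := linI_main _ hW (k + 1) _ List.suffix_rfl s
  rw [hI'] at h
  exact free_of_resMin I k (Lin.resMin I (k + 1) _ _ h)
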